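/- For every real x > 0, ψ(x) = log x − ∫_0^∞ e^{−tx}·(t·f(t) + 1/2) dt, where f(t) = (1/2 − 1/t + 1/(e^t − 1))/t for t > 0. -/

import Mathlib

/-- The digamma function `ψ(x) = Γ'(x)/Γ(x)`. -/
noncomputable def digamma (x : ℝ) : ℝ := deriv (fun y => Real.log (Real.Gamma y)) x

/-- The auxiliary function `f(t) = (1/2 − 1/t + 1/(e^t − 1))/t`. -/
noncomputable def binetAux (t : ℝ) : ℝ := (1/2 - 1/t + 1/(Real.exp t - 1)) / t

open Real Set Filter Topology MeasureTheory

lemma differentiableAt_log_Gamma {x : ℝ} (hx : 0 < x) :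
    DifferentiableAt ℝ (fun y => log (Gamma y)) x :=
  (differentiableAt_Gamma fun m => ((neg_nonpos.2 m.cast_nonneg).trans_lt hx).ne').log (Gamma_pos_of_pos hx).ne'

lemma log_Gamma_add_one {x : ℝ} (hx : 0 < x) :
    log (Gamma (x + 1)) = log (Gamma x) + log x := by
  rw [Gamma_add_one hx.ne', log_mul hx.ne' (Gamma_pos_of_pos hx).ne', add_comm]

lemma digamma_add_one {x : ℝ} (hx : 0 < x) : digamma (x + 1) = digamma x + 1 / x := by
  unfold digamma
  rw [← deriv_comp_add_const, one_div, ← deriv_log,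
    ← deriv_fun_add (differentiableAt_log_Gamma hx) (differentiableAt_log hx.ne')]
  apply EventuallyEq.deriv_eq
  filter_upwards [eventually_gt_nhds hx] with y hy using log_Gamma_add_one hy

lemma digamma_le_log {x : ℝ} (hx : 0 < x) : digamma x ≤ log x := by
  refine (convexOn_log_Gamma.deriv_le_slope (mem_Ioi.2 hx) (mem_Ioi.2 (by positivity : 0 < x + 1))
    (lt_add_one x) (differentiableAt_log_Gamma hx)).trans_eq ?_
  rw [slope_def_field, Function.comp_apply, Function.comp_apply, log_Gamma_add_one hx]
  ring

lemma log_le_digamma_add_one {x : ℝ} (hx : 0 < x) : log x ≤ digamma (x + 1) := by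
  refine Eq.trans_le ?_ (convexOn_log_Gamma.slope_le_deriv (mem_Ioi.2 hx)
    (mem_Ioi.2 (by positivity : 0 < x + 1)) (lt_add_one x)
    (differentiableAt_log_Gamma (by positivity)))
  rw [slope_def_field, Function.comp_apply, Function.comp_apply, log_Gamma_add_one hx]
  ring

lemma tendsto_digamma_sub_log : Tendsto (fun x => digamma x - log x) atTop (𝓝 0) := by
  have hlim : Tendsto (fun x : ℝ => -(1 / x)) atTop (𝓝 0) := by
    simpa using (tendsto_inv_atTop_zero (𝕜 := ℝ)).neg
  refine tendsto_of_tendsto_of_tendsto_of_le_of_le' hlim tendsto_const_nhds ?_ ?_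
  · filter_upwards [eventually_gt_atTop 0] with x hx
    have h := log_le_digamma_add_one hx
    rw [digamma_add_one hx] at h
    linarith
  · filter_upwards [eventually_gt_atTop 0] with x hx
    linarith [digamma_le_log hx]

lemma mul_binetAux_add_half {t : ℝ} (ht : 0 < t) :
    t * binetAux t + 1 / 2 = 1 - 1 / t + 1 / (exp t - 1) := by
  unfold binetAux
  rw [mul_div_cancel₀ _ ht.ne']
  ring

lemma mul_binetAux_add_half_le_one {t : ℝ} (ht : 0 < t) : t * binetAux t + 1 / 2 ≤ 1 := by
  rw [mul_binetAux_add_half ht]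
  have h : 1 / (exp t - 1) ≤ 1 / t :=
    one_div_le_one_div_of_le ht (by linarith [add_one_le_exp t])
  linarith

lemma mul_binetAux_add_half_nonneg {t : ℝ} (ht : 0 < t) : 0 ≤ t * binetAux t + 1 / 2 := by
  rw [mul_binetAux_add_half ht]
  have hpos : 0 < exp t - 1 := by linarith [add_one_le_exp t]
  have h : exp t - 1 ≤ t * exp t := by
    have h1 := mul_le_mul_of_nonneg_right (add_one_le_exp (-t)) (exp_pos t).le
    rw [← exp_add, neg_add_cancel, exp_zero] at h1
    linarith
  have hdiv : 1 / t ≤ exp t / (exp t - 1) := by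
    rw [div_le_div_iff₀ ht hpos]
    linarith
  have hsplit : exp t / (exp t - 1) = 1 + 1 / (exp t - 1) := by
    field_simp
    ring
  linarith

lemma integrableOn_exp_neg_mul {x : ℝ} (hx : 0 < x) :
    IntegrableOn (fun t => exp (-t * x)) (Ioi 0) := by
  simpa only [neg_mul, mul_comm x] using exp_neg_integrableOn_Ioi 0 hx

lemma integral_exp_neg_mul {x : ℝ} (hx : 0 < x) :
    ∫ t in Ioi (0 : ℝ), exp (-t * x) = 1 / x := by
  have h := integral_exp_mul_Ioi (neg_lt_zero.2 hx) 0
  simp only [mul_zero, exp_zero, neg_div_neg_eq] at h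
  simpa only [neg_mul, mul_comm x] using h

lemma integrableOn_exp_neg_mul_binetAux {x : ℝ} (hx : 0 < x) :
    IntegrableOn (fun t => exp (-t * x) * (t * binetAux t + 1 / 2)) (Ioi 0) := by
  refine (integrableOn_exp_neg_mul hx).mono' ?_ ?_
  · unfold binetAux
    exact Measurable.aestronglyMeasurable (by fun_prop)
  · filter_upwards [ae_restrict_mem measurableSet_Ioi] with t ht
    rw [norm_of_nonneg (mul_nonneg (exp_pos _).le (mul_binetAux_add_half_nonneg ht))]
    exact mul_le_of_le_one_right (exp_pos _).le (mul_binetAux_add_half_le_one ht)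

lemma tendsto_integral_exp_neg_mul_binetAux :
    Tendsto (fun x => ∫ t in Ioi (0 : ℝ), exp (-t * x) * (t * binetAux t + 1 / 2))
      atTop (𝓝 0) := by
  have hlim : Tendsto (fun x : ℝ => 1 / x) atTop (𝓝 0) := by
    simpa using tendsto_inv_atTop_zero (𝕜 := ℝ)
  refine tendsto_of_tendsto_of_tendsto_of_le_of_le' tendsto_const_nhds hlim ?_ ?_
  · filter_upwards with x
    exact setIntegral_nonneg measurableSet_Ioi fun t ht =>
      mul_nonneg (exp_pos _).le (mul_binetAux_add_half_nonneg ht)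
  · filter_upwards [eventually_gt_atTop 0] with x hx
    rw [← integral_exp_neg_mul hx]
    exact setIntegral_mono_on (integrableOn_exp_neg_mul_binetAux hx) (integrableOn_exp_neg_mul hx)
      measurableSet_Ioi fun t ht =>
        mul_le_of_le_one_right (exp_pos _).le (mul_binetAux_add_half_le_one ht)

lemma integral_exp_neg_mul_binetAux_sub {x : ℝ} (hx : 0 < x) :
    (∫ t in Ioi (0 : ℝ), exp (-t * x) * (t * binetAux t + 1 / 2)) -
      ∫ t in Ioi (0 : ℝ), exp (-t * (x + 1)) * (t * binetAux t + 1 / 2) =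
      1 / x - (log (x + 1) - log x) := by
  have hx1 : 0 < x + 1 := by positivity
  have hint : IntegrableOn (fun t => exp (-t * x) * (t * binetAux t + 1 / 2) -
      exp (-t * (x + 1)) * (t * binetAux t + 1 / 2)) (Ioi 0) :=
    (integrableOn_exp_neg_mul_binetAux hx).sub (integrableOn_exp_neg_mul_binetAux hx1)
  have hpt : ∀ t ∈ Ioi (0 : ℝ), exp (-t * x) -
      (exp (-t * x) * (t * binetAux t + 1 / 2) - exp (-t * (x + 1)) * (t * binetAux t + 1 / 2)) =
      t⁻¹ • (exp (-(x * t)) - exp (-((x + 1) * t))) := by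
    intro t ht
    have ht0 : t ≠ 0 := (mem_Ioi.1 ht).ne'
    have hpos : exp t - 1 ≠ 0 := (sub_pos.2 (one_lt_exp_iff.2 ht)).ne'
    have hexp : exp (-(x * t)) = exp (-((x + 1) * t)) * exp t := by
      rw [← exp_add]
      ring_nf
    rw [mul_binetAux_add_half ht, neg_mul, neg_mul, mul_comm t x, mul_comm t (x + 1), hexp,
      smul_eq_mul]
    field_simp
    ring
  have hfrul : IntegrableOn (fun t : ℝ => t⁻¹ • (exp (-(x * t)) - exp (-((x + 1) * t)))) (Ioi 0) :=
    IntegrableOn.congr_fun ((integrableOn_exp_neg_mul hx).sub hint) hpt measurableSet_Ioi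
  have hfru := Frullani.integral_Ioi_eq (f := fun t : ℝ => exp (-t)) (L := 1) (R := 0)
    ((by fun_prop : Continuous fun t : ℝ => exp (-t)).locallyIntegrable.locallyIntegrableOn _)
    hx hx1 ((by simpa using (by fun_prop : Continuous fun t : ℝ => exp (-t)).tendsto 0 :
      Tendsto (fun t : ℝ => exp (-t)) (𝓝 0) (𝓝 1)).mono_left nhdsWithin_le_nhds)
    (tendsto_exp_neg_atTop_nhds_zero) hfrul
  rw [← setIntegral_congr_fun measurableSet_Ioi hpt,
    integral_sub (integrableOn_exp_neg_mul hx) hint, integral_exp_neg_mul hx,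
    integral_sub (integrableOn_exp_neg_mul_binetAux hx) (integrableOn_exp_neg_mul_binetAux hx1),
    log_div hx1.ne' hx.ne', sub_zero, smul_eq_mul, mul_one] at hfru
  linarith

theorem digamma_integral_repr (x : ℝ) (hx : 0 < x) :
    digamma x = Real.log x -
      ∫ t in Set.Ioi (0 : ℝ), Real.exp (-t * x) * (t * binetAux t + 1/2) := by
  set D : ℝ → ℝ := fun y => digamma y - log y +
    ∫ t in Ioi (0 : ℝ), exp (-t * y) * (t * binetAux t + 1 / 2) with hD
  have hstep {y : ℝ} (hy : 0 < y) : D (y + 1) = D y := by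
    have h := integral_exp_neg_mul_binetAux_sub hy
    simp only [hD, digamma_add_one hy]
    linarith
  have hperiod (n : ℕ) : D (x + n) = D x := by
    induction n with
    | zero => simp
    | succ n ih => rw [Nat.cast_succ, ← add_assoc, hstep (by positivity), ih]
  have hlim : Tendsto D atTop (𝓝 0) := by
    simpa only [add_zero] using tendsto_digamma_sub_log.add tendsto_integral_exp_neg_mul_binetAux
  have hzero : D x = 0 := by
    refine tendsto_nhds_unique (tendsto_const_nhds.congr fun n => (hperiod n).symm)
      (hlim.comp (tendsto_atTop_add_const_left _ x tendsto_natCast_atTop_atTop))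
  simp only [hD] at hzero
  linarith
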